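/- arXiv:0908.2476 — 5 statements merged into one kernel-verified Lean document; each statement's English description precedes it below -/
import Mathlib

section
/- Special soundness (witness extraction) of the DLP-based Σ-protocol for a committed discrete logarithm: let G be a commutative group, q a prime number, and g, h, x, ḡ, h̄, a₀, a₁ elements of G with x^q = 1, ḡ^q = 1, and h̄^q = 1. Suppose e, e', z₀, z₀', z₁, z₁' are integers such that (a₀, a₁, e, z₀, z₁) and (a₀, a₁, e', z₀', z₁') are both accepting transcripts (with the same first message a₀, a₁) and q does not divide e − e'. Then there exist integers w and r such that x = g^w, ḡ = g^r, and h̄ = g^w · h^r. -/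
theorem eq_zpow_of_zpow_eq_mul_zpow {G : Type*} [CommGroup G] {a c y : G}
    {q e e' m n u v : ℤ} (hy : y ^ q = 1) (hm : a ^ m = c * y ^ e) (hn : a ^ n = c * y ^ e')
    (huv : u * (e - e') + v * q = 1) : y = a ^ (u * (m - n)) := by
  have hd : a ^ (m - n) = y ^ (e - e') := by
    rw [zpow_sub, zpow_sub, hm, hn, ← div_eq_mul_inv, ← div_eq_mul_inv, mul_div_mul_left_eq_div]
  calc
    y = y ^ (u * (e - e') + v * q) := by rw [huv, zpow_one]
    _ = a ^ (u * (m - n)) := by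
      rw [zpow_add, zpow_mul', zpow_mul' y v, hy, one_zpow, mul_one, ← hd, ← zpow_mul']

/-- Special soundness (witness extraction) of the DLP-based Σ-protocol for a
committed discrete logarithm. -/
theorem sigma_dlp_special_soundness {G : Type*} [CommGroup G] (q : ℕ) (hq : q.Prime)
    (g h x gbar hbar a₀ a₁ : G)
    (hxq : x ^ q = 1) (hgbarq : gbar ^ q = 1) (hhbarq : hbar ^ q = 1)
    (e e' z₀ z₀' z₁ z₁' : ℤ)
    (h1 : g ^ z₀ = a₀ * x ^ e) (h2 : g ^ z₁ = a₀ * gbar ^ e)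
    (h3 : h ^ z₁ = a₁ * (hbar * x⁻¹) ^ e)
    (h1' : g ^ z₀' = a₀ * x ^ e') (h2' : g ^ z₁' = a₀ * gbar ^ e')
    (h3' : h ^ z₁' = a₁ * (hbar * x⁻¹) ^ e')
    (hne : ¬ ((q : ℤ) ∣ e - e')) :
    ∃ w r : ℤ, x = g ^ w ∧ gbar = g ^ r ∧ hbar = g ^ w * h ^ r := by
  obtain ⟨v, u, huv⟩ : IsCoprime (q : ℤ) (e - e') :=
    (Nat.prime_iff_prime_int.mp hq).irreducible.coprime_iff_not_dvd.mpr hne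
  rw [add_comm] at huv
  have hx : x ^ (q : ℤ) = 1 := by rw [zpow_natCast, hxq]
  have hgbar : gbar ^ (q : ℤ) = 1 := by rw [zpow_natCast, hgbarq]
  have hquot : (hbar * x⁻¹) ^ (q : ℤ) = 1 := by
    rw [zpow_natCast, mul_pow, inv_pow, hxq, hhbarq, inv_one, mul_one]
  have hxw := eq_zpow_of_zpow_eq_mul_zpow hx h1 h1' huv
  refine ⟨u * (z₀ - z₀'), u * (z₁ - z₁'), hxw,
    eq_zpow_of_zpow_eq_mul_zpow hgbar h2 h2' huv, ?_⟩
  rw [← hxw, ← eq_zpow_of_zpow_eq_mul_zpow hquot h3 h3' huv, mul_comm hbar, mul_inv_cancel_left]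
end

section
/- Discrete-logarithm extraction lemma: let G be a group, x and g elements of G, q a natural number, and d, m integers such that x^q = 1, x^d = g^m, and gcd(d, q) = 1 (as integers). Then there exists an integer w such that x = g^w. -/
/-- Discrete-logarithm extraction lemma: from `x ^ q = 1`, `x ^ d = g ^ m` and
`gcd(d, q) = 1` one can express `x` as an integer power of `g`. -/
theorem dlog_extraction {G : Type*} [Group G] (x g : G) (q : ℕ) (d m : ℤ)
    (hxq : x ^ q = 1) (hxd : x ^ d = g ^ m) (hgcd : Int.gcd d (q : ℤ) = 1) :
    ∃ w : ℤ, x = g ^ w := by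
  obtain ⟨a, b, hab⟩ := Int.isCoprime_iff_gcd_eq_one.mpr hgcd
  refine ⟨m * a, ?_⟩
  calc x = x ^ (d * a + q * b) := by rw [mul_comm d, mul_comm (q : ℤ), hab, zpow_one]
    _ = g ^ (m * a) := by
      rw [zpow_add, zpow_mul, zpow_mul, zpow_natCast, hxq, one_zpow, mul_one, hxd, ← zpow_mul]
end

section
/- Perfect binding of the ElGamal commitment scheme: let G be a commutative group, g an element of G of order exactly q (a natural number), u an integer, and h = g^u. If integers r₁, v₁, r₂, v₂ satisfy g^{r₁} = g^{r₂} and g^{v₁} · h^{r₁} = g^{v₂} · h^{r₂}, then q divides v₁ − v₂ (as integers). In particular, a commitment tuple (h, g^r, g^v · h^r) determines the committed value v uniquely modulo q. -/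
/-- Perfect binding of the ElGamal commitment scheme: a commitment
`(h, g^r, g^v * h^r)` determines the committed value `v` uniquely modulo `q`,
the order of `g`. -/
theorem elgamal_perfect_binding {G : Type*} [CommGroup G] (g : G) (q : ℕ)
    (hq : orderOf g = q) (u : ℤ) (h : G) (hh : h = g ^ u)
    (r₁ v₁ r₂ v₂ : ℤ)
    (hr : g ^ r₁ = g ^ r₂) (hv : g ^ v₁ * h ^ r₁ = g ^ v₂ * h ^ r₂) :
    (q : ℤ) ∣ v₁ - v₂ := by
  have h_mask : h ^ r₁ = h ^ r₂ := by
    rw [hh, zpow_comm g u r₁, zpow_comm g u r₂, hr]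
  rw [h_mask] at hv
  rw [← hq, orderOf_dvd_iff_zpow_eq_one, zpow_sub, mul_right_cancel hv, mul_inv_cancel]
end

section
/- Special soundness of Schnorr's Σ-protocol for discrete logarithm: let G be a commutative group, q a prime number, and g, h, a elements of G with h^q = 1. Suppose e, e', z, z' are integers such that g^z = a · h^e, g^{z'} = a · h^{e'}, and q does not divide e − e'. Then there exists an integer w such that h = g^w and q divides (e − e')·w − (z − z'). -/
/-- Special soundness of Schnorr's Σ-protocol for discrete logarithm. -/
theorem schnorr_special_soundness {G : Type*} [CommGroup G] (q : ℕ) (hq : q.Prime)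
    (g h a : G) (hhq : h ^ q = 1) (e e' z z' : ℤ)
    (h1 : g ^ z = a * h ^ e) (h2 : g ^ z' = a * h ^ e')
    (hne : ¬ ((q : ℤ) ∣ e - e')) :
    ∃ w : ℤ, h = g ^ w ∧ (q : ℤ) ∣ (e - e') * w - (z - z') := by
  have hdiff : g ^ (z - z') = h ^ (e - e') := by
    rw [zpow_sub, zpow_sub, h1, h2, ← div_eq_mul_inv, ← div_eq_mul_inv, mul_div_mul_left_eq_div]
  obtain ⟨v, u, huv⟩ := (Nat.prime_iff_prime_int.mp hq).coprime_iff_not_dvd.mpr hne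
  refine ⟨(z - z') * u, ?_, -(z - z') * v, by linear_combination (z - z') * huv⟩
  calc h = h ^ (v * q + u * (e - e')) := by rw [huv, zpow_one]
    _ = g ^ ((z - z') * u) := by
      rw [zpow_add, mul_comm v, zpow_mul, zpow_natCast, hhq, one_zpow, one_mul, mul_comm u,
        zpow_mul, zpow_mul, hdiff]
end

section
/- Special soundness (secret-key extraction) of the Σ_OR-protocol for a public key pair (y₀, y₁): let G be a commutative group, q a prime number, k a natural number with 2^k < q, and g, y₀, y₁, a₀, a₁ elements of G with y₀^q = 1 and y₁^q = 1. Suppose there are two accepting Σ_OR conversations with the same first message (a₀, a₁): k-bit challenges s ≠ s' (elements of BitVec k), and responses (e₀, z₀, e₁, z₁) and (e₀', z₀', e₁', z₁') with e₀, e₁, e₀', e₁' in BitVec k and z₀, z₁, z₀', z₁' integers, satisfying s = e₀ XOR e₁, s' = e₀' XOR e₁', g^{z₀} = a₀ · y₀^{e₀.toNat}, g^{z₁} = a₁ · y₁^{e₁.toNat}, g^{z₀'} = a₀ · y₀^{e₀'.toNat}, and g^{z₁'} = a₁ · y₁^{e₁'.toNat}. Then there exists an integer w such that y₀ = g^w or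 y₁ = g^w. -/
/-- Special soundness of Schnorr's Σ-protocol: two accepting conversations with the same first
message and challenges whose difference is coprime to the exponent of `y` yield a preimage. -/
theorem exists_eq_zpow_of_schnorr {G : Type*} [CommGroup G] {g y a : G} {q c c' : ℕ} {z z' : ℤ}
    (hy : y ^ q = 1) (hc : IsCoprime ((c : ℤ) - c') q)
    (h : g ^ z = a * y ^ c) (h' : g ^ z' = a * y ^ c') : ∃ w : ℤ, y = g ^ w := by
  obtain ⟨u, v, huv⟩ := hc
  have hdiff : g ^ (z - z') = y ^ ((c : ℤ) - c') := by
    rw [zpow_sub, zpow_sub, h, h', zpow_natCast, zpow_natCast, mul_inv, mul_mul_mul_comm,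
      mul_inv_cancel, one_mul]
  refine ⟨(z - z') * u, ?_⟩
  calc
    y = y ^ (u * ((c : ℤ) - c') + v * q) := by rw [huv, zpow_one]
    _ = g ^ ((z - z') * u) := by
      rw [zpow_add, mul_comm u, mul_comm v, zpow_mul, zpow_mul, zpow_natCast, hy, one_zpow,
        mul_one, ← hdiff, ← zpow_mul]

theorem BitVec.isCoprime_toNat_sub_toNat {k q : ℕ} (hq : q.Prime) (hk : 2 ^ k < q)
    {e e' : BitVec k} (hne : e ≠ e') : IsCoprime ((e.toNat : ℤ) - e'.toNat) q := by
  refine ((Nat.prime_iff_prime_int.mp hq).coprime_iff_not_dvd.mpr fun hdvd => ?_).symm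
  have he := e.isLt
  have he' := e'.isLt
  have hzero := Int.eq_zero_of_abs_lt_dvd hdvd (abs_lt.mpr ⟨by omega, by omega⟩)
  exact hne (BitVec.eq_of_toNat_eq (by omega))

/-- Special soundness (secret-key extraction) of the Σ_OR-protocol for a public
key pair `(y₀, y₁)`: from two accepting Σ_OR conversations with the same first
message and distinct `k`-bit challenges, one extracts a preimage of `y₀` or of
`y₁` under exponentiation by `g`. -/
theorem sigma_or_special_soundness {G : Type*} [CommGroup G] (q : ℕ) (hq : q.Prime)
    (k : ℕ) (hk : 2 ^ k < q) (g y₀ y₁ a₀ a₁ : G)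
    (hy₀ : y₀ ^ q = 1) (hy₁ : y₁ ^ q = 1)
    (s s' e₀ e₁ e₀' e₁' : BitVec k) (z₀ z₁ z₀' z₁' : ℤ)
    (hss' : s ≠ s')
    (hxor : s = e₀ ^^^ e₁) (hxor' : s' = e₀' ^^^ e₁')
    (h1 : g ^ z₀ = a₀ * y₀ ^ e₀.toNat) (h2 : g ^ z₁ = a₁ * y₁ ^ e₁.toNat)
    (h1' : g ^ z₀' = a₀ * y₀ ^ e₀'.toNat) (h2' : g ^ z₁' = a₁ * y₁ ^ e₁'.toNat) :
    ∃ w : ℤ, y₀ = g ^ w ∨ y₁ = g ^ w := by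
  by_cases he₀ : e₀ = e₀'
  · have he₁ : e₁ ≠ e₁' := fun he₁ => hss' (by rw [hxor, hxor', he₀, he₁])
    obtain ⟨w, hw⟩ := exists_eq_zpow_of_schnorr hy₁
      (BitVec.isCoprime_toNat_sub_toNat hq hk he₁) h2 h2'
    exact ⟨w, Or.inr hw⟩
  · obtain ⟨w, hw⟩ := exists_eq_zpow_of_schnorr hy₀
      (BitVec.isCoprime_toNat_sub_toNat hq hk he₀) h1 h1'
    exact ⟨w, Or.inl hw⟩
end
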